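/- Let A ∈ ℝ^{d×d} be symmetric, k ≥ 1 a real number, and suppose w* ∈ ℝ^d, μ* ≥ 0, λ* ∈ ℝ, and a symmetric matrix Z* ∈ ℝ^{d×d} satisfy: ‖w*‖₁ ≤ √k, ‖w*‖₂ = 1; |Z*_{ij}| ≤ 1 for all i,j, Z*_{ij} = sign(w*_i)·sign(w*_j) whenever w*_i·w*_j ≠ 0, λ*·I_d − A + μ*·Z* ⪰ 0; μ*·(‖w*‖₁ − √k) = 0 and (λ*·I_d − A + μ*·Z*)·w* = 0. If additionally rank(λ*·I_d − A + μ*·Z*) = d − 1, then w*·(w*)ᵀ is the unique optimal solution of SPCA-SDP with input (A,k): every feasible W with tr(AW) = tr(A·w*·(w*)ᵀ) equals w*·(w*)ᵀ. -/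

import Mathlib

open Matrix Finset

/-- `W` is a feasible solution of the basic SDP relaxation SPCA-SDP with input `(A, k)`:
`W ⪰ 0`, `tr W = 1`, and the entrywise 1-norm of `W` is at most `k`. -/
def SDPFeasible {d : ℕ} (k : ℝ) (W : Matrix (Fin d) (Fin d) ℝ) : Prop :=
  W.PosSemidef ∧ W.trace = 1 ∧ ∑ i, ∑ j, |W i j| ≤ k

open scoped MatrixOrder in
theorem Matrix.PosSemidef.trace_mul_nonneg_and_mul_eq_zero {n : Type*} [Fintype n]
    [DecidableEq n] {M W : Matrix n n ℝ} (hM : M.PosSemidef) (hW : W.PosSemidef) :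
    0 ≤ (M * W).trace ∧ ((M * W).trace = 0 → M * W = 0) := by
  obtain ⟨B, rfl⟩ := CStarAlgebra.nonneg_iff_eq_star_mul_self.mp hM.nonneg
  obtain ⟨C, rfl⟩ := CStarAlgebra.nonneg_iff_eq_star_mul_self.mp hW.nonneg
  simp only [star_eq_conjTranspose]
  have htrace : (Bᴴ * B * (Cᴴ * C)).trace = ((B * Cᴴ)ᴴ * (B * Cᴴ)).trace := by
    rw [← Matrix.mul_assoc, trace_mul_comm, conjTranspose_mul, conjTranspose_conjTranspose]
    simp only [Matrix.mul_assoc]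
  rw [htrace]
  refine ⟨(posSemidef_conjTranspose_mul_self _).trace_nonneg, fun h => ?_⟩
  rw [trace_conjTranspose_mul_self_eq_zero_iff] at h
  rw [show Bᴴ * B * (Cᴴ * C) = Bᴴ * (B * Cᴴ) * C by simp only [Matrix.mul_assoc], h]
  simp

theorem Matrix.trace_mul_le_sum_abs {m n : Type*} [Fintype m] [Fintype n]
    {Z : Matrix m n ℝ} {W : Matrix n m ℝ} (hZ : ∀ i j, |Z i j| ≤ 1) :
    (Z * W).trace ≤ ∑ i, ∑ j, |W i j| := by
  rw [Finset.sum_comm]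
  simp only [trace, diag_apply, mul_apply]
  gcongr with i _ j _
  calc Z i j * W j i ≤ |Z i j| * |W j i| := by rw [← abs_mul]; exact le_abs_self _
    _ ≤ |W j i| := mul_le_of_le_one_left (abs_nonneg _) (hZ i j)

theorem Matrix.exists_smul_of_mulVec_eq_zero_of_rank {d : ℕ} {M : Matrix (Fin d) (Fin d) ℝ}
    {w v : Fin d → ℝ} (hrank : M.rank = d - 1) (hw : w ≠ 0) (hMw : M *ᵥ w = 0)
    (hMv : M *ᵥ v = 0) : ∃ c : ℝ, v = c • w := by
  have hd : d ≠ 0 := by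
    rintro rfl
    exact hw (Subsingleton.elim _ _)
  have hker : Module.finrank ℝ (LinearMap.ker M.mulVecLin) = 1 := by
    have h := M.mulVecLin.finrank_range_add_finrank_ker
    rw [Module.finrank_fin_fun] at h
    rw [Matrix.rank] at hrank
    omega
  let w' : LinearMap.ker M.mulVecLin := ⟨w, hMw⟩
  have hw' : w' ≠ 0 := fun h => hw (congrArg Subtype.val h)
  obtain ⟨c, hc⟩ := (finrank_eq_one_iff_of_nonzero' w' hw').mp hker ⟨v, hMv⟩
  exact ⟨c, (congrArg Subtype.val hc).symm⟩

theorem Matrix.eq_vecMulVec_of_mul_eq_zero_of_rank {d : ℕ} {M W : Matrix (Fin d) (Fin d) ℝ}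
    {w : Fin d → ℝ} (hrank : M.rank = d - 1) (hw : ∑ i, w i ^ 2 = 1) (hMw : M *ᵥ w = 0)
    (hMW : M * W = 0) (hW : W.IsSymm) (htr : W.trace = 1) : W = vecMulVec w w := by
  have hw0 : w ≠ 0 := by
    rintro rfl
    simp at hw
  have hcol (j : Fin d) : ∃ c : ℝ, W.col j = c • w :=
    exists_smul_of_mulVec_eq_zero_of_rank hrank hw0 hMw
      (by ext i; exact congrFun (congrFun hMW i) j)
  choose c hc using hcol
  have hWc (i j : Fin d) : W i j = c j * w i := congrFun (hc j) i
  have hcw (j : Fin d) : c j = (∑ i, c i * w i) * w j :=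
    calc c j = c j * ∑ i, w i ^ 2 := by rw [hw, mul_one]
      _ = ∑ i, W i j * w i := by
        rw [Finset.mul_sum]
        exact Finset.sum_congr rfl fun i _ => by rw [hWc]; ring
      _ = (∑ i, c i * w i) * w j := by
        rw [Finset.sum_mul]
        exact Finset.sum_congr rfl fun i _ => by rw [← hW.apply i j, hWc]; ring
  have hc1 : ∑ i, c i * w i = 1 := by
    rw [← htr]
    exact Finset.sum_congr rfl fun i _ => (hWc i i).symm
  ext i j
  rw [hWc, hcw, hc1, vecMulVec_apply]
  ring

theorem sum_sum_abs_vecMulVec {n : Type*} [Fintype n] (w : n → ℝ) :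
    ∑ i, ∑ j, |vecMulVec w w i j| = (∑ i, |w i|) ^ 2 := by
  simp only [vecMulVec_apply, abs_mul, sq, Finset.sum_mul_sum]

theorem Real.abs_eq_sign_mul (r : ℝ) : |r| = Real.sign r * r := by
  rcases lt_trichotomy r 0 with h | rfl | h
  · rw [Real.sign_of_neg h, abs_of_neg h, neg_one_mul]
  · simp
  · rw [Real.sign_of_pos h, abs_of_pos h, one_mul]

theorem Matrix.trace_mul_vecMulVec_eq_of_sign {n : Type*} [Fintype n] {Z : Matrix n n ℝ}
    {w : n → ℝ} (hZ : ∀ i j, w i * w j ≠ 0 → Z i j = Real.sign (w i) * Real.sign (w j)) :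
    (Z * vecMulVec w w).trace = (∑ i, |w i|) ^ 2 := by
  rw [sq, Finset.sum_mul_sum]
  simp only [trace, diag_apply, mul_apply, vecMulVec_apply]
  refine Finset.sum_congr rfl fun i _ => Finset.sum_congr rfl fun j _ => ?_
  by_cases h : w i * w j = 0
  · rw [mul_comm (w j), h, mul_zero, ← abs_mul, h, abs_zero]
  · rw [hZ i j h, Real.abs_eq_sign_mul (w i), Real.abs_eq_sign_mul (w j)]
    ring

/-- Under the KKT-type conditions, if in addition
`rank(λ* I − A + μ* Z*) = d − 1`, then `w* (w*)ᵀ` is the unique optimal solution of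
SPCA-SDP with input `(A, k)`: every feasible `W` whose objective value equals that of
`w* (w*)ᵀ` is equal to `w* (w*)ᵀ`. -/
theorem KKT_rank_condition_unique_SDP_optimum
    (d : ℕ) (A : Matrix (Fin d) (Fin d) ℝ) (hA : A.IsSymm)
    (k : ℝ) (hk : 1 ≤ k)
    (w : Fin d → ℝ) (mu lam : ℝ) (Z : Matrix (Fin d) (Fin d) ℝ) (hZsymm : Z.IsSymm)
    (hw1 : ∑ i, |w i| ≤ Real.sqrt k)
    (hw2 : ∑ i, w i ^ 2 = 1)
    (hmu : 0 ≤ mu)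
    (hZbound : ∀ i j, |Z i j| ≤ 1)
    (hZsign : ∀ i j, w i * w j ≠ 0 → Z i j = Real.sign (w i) * Real.sign (w j))
    (hpsd : (lam • (1 : Matrix (Fin d) (Fin d) ℝ) - A + mu • Z).PosSemidef)
    (hcs1 : mu * ((∑ i, |w i|) - Real.sqrt k) = 0)
    (hcs2 : (lam • (1 : Matrix (Fin d) (Fin d) ℝ) - A + mu • Z).mulVec w = 0)
    (hrank : (lam • (1 : Matrix (Fin d) (Fin d) ℝ) - A + mu • Z).rank = d - 1) :
    SDPFeasible k (vecMulVec w w) ∧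
      (∀ W : Matrix (Fin d) (Fin d) ℝ, SDPFeasible k W →
        (A * W).trace ≤ (A * vecMulVec w w).trace) ∧
      ∀ W : Matrix (Fin d) (Fin d) ℝ, SDPFeasible k W →
        (A * W).trace = (A * vecMulVec w w).trace → W = vecMulVec w w := by
  set M := lam • (1 : Matrix (Fin d) (Fin d) ℝ) - A + mu • Z with hM
  have hk0 : 0 ≤ k := zero_le_one.trans hk
  have hfeas : SDPFeasible k (vecMulVec w w) := by
    refine ⟨by simpa using posSemidef_vecMulVec_self_star w, ?_, ?_⟩
    · rw [trace_vecMulVec, ← hw2]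
      exact Finset.sum_congr rfl fun i _ => (sq (w i)).symm
    · rw [sum_sum_abs_vecMulVec]
      exact (Real.le_sqrt (by positivity) hk0).mp hw1
  have hobj (W : Matrix (Fin d) (Fin d) ℝ) (hW : W.trace = 1) :
      (A * W).trace = lam + mu * (Z * W).trace - (M * W).trace := by
    simp [hM, Matrix.add_mul, Matrix.sub_mul, hW]
  have hopt : (A * vecMulVec w w).trace = lam + mu * k := by
    have hmuk : mu * (∑ i, |w i|) ^ 2 = mu * k := by
      linear_combination ((∑ i, |w i|) + √k) * hcs1 + mu * Real.sq_sqrt hk0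
    rw [hobj _ hfeas.2.1, trace_mul_vecMulVec_eq_of_sign hZsign, mul_vecMulVec, hcs2, hmuk]
    simp
  have hZW (W : Matrix (Fin d) (Fin d) ℝ) (hW : SDPFeasible k W) :
      mu * (Z * W).trace ≤ mu * k :=
    mul_le_mul_of_nonneg_left ((trace_mul_le_sum_abs hZbound).trans hW.2.2) hmu
  refine ⟨hfeas, fun W hW => ?_, fun W hW heq => ?_⟩
  · rw [hopt, hobj W hW.2.1]
    linarith [hZW W hW, (hpsd.trace_mul_nonneg_and_mul_eq_zero hW.1).1]
  · obtain ⟨hnonneg, hzero⟩ := hpsd.trace_mul_nonneg_and_mul_eq_zero hW.1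
    rw [hopt, hobj W hW.2.1] at heq
    refine eq_vecMulVec_of_mul_eq_zero_of_rank hrank hw2 hcs2 (hzero ?_) ?_ hW.2.1
    · linarith [hZW W hW]
    · simpa [IsSymm, IsHermitian, conjTranspose_eq_transpose_of_trivial] using hW.1.isHermitian
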